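/- Let p be a prime and N₀ a positive integer. Then every finite group G possessing a normal Sylow p-subgroup P with |P| ≤ N₀ and cyclic quotient G/P contains a normal subgroup H of order prime to p with index [G : H] ≤ N₀ · N₀!. -/

import Mathlib

/-- The index of the kernel of the conjugation action on a normal subgroup `N` of finite order
is at most `|N|!`. -/
theorem Subgroup.index_ker_conjNormal_le {G : Type*} [Group G] (N : Subgroup G) [N.Normal]
    [Finite N] : (MulAut.conjNormal (H := N)).ker.index ≤ (Nat.card N).factorial := by
  have hker : ((MulAut.toPerm N).comp (MulAut.conjNormal (H := N))).ker =
      (MulAut.conjNormal (H := N)).ker :=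
    MonoidHom.ker_comp_of_injective _ _ MulEquiv.toEquiv_injective
  rw [← hker, Subgroup.index_ker, ← Nat.card_perm]
  exact Subgroup.card_le_card_group _

/-- If `K` is a complement of a normal subgroup `N`, the elements of `K` that centralize `N` form
a normal subgroup of the whole group. -/
theorem Subgroup.IsComplement'.normal_inf_ker_conjNormal {G : Type*} [Group G] {N K : Subgroup G}
    [N.Normal] (h : N.IsComplement' K) : (K ⊓ (MulAut.conjNormal (H := N)).ker).Normal := by
  refine ⟨fun n hn g => ?_⟩
  obtain ⟨⟨⟨a, ha⟩, ⟨b, hb⟩⟩, rfl⟩ := h.2 g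
  have hm : b * n * b⁻¹ ∈ K ⊓ (MulAut.conjNormal (H := N)).ker :=
    ⟨K.mul_mem (K.mul_mem hb hn.1) (K.inv_mem hb),
      (inferInstance : (MulAut.conjNormal (H := N)).ker.Normal).conj_mem n hn.2 b⟩
  have hcomm : b * n * b⁻¹ * a * (b * n * b⁻¹)⁻¹ = a := by
    have := congrArg Subtype.val (DFunLike.congr_fun (MonoidHom.mem_ker.mp hm.2) ⟨a, ha⟩)
    simpa only [MulAut.conjNormal_apply, MulAut.one_apply] using this
  have heq : a * b * n * (a * b)⁻¹ = b * n * b⁻¹ := by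
    have := mul_inv_eq_iff_eq_mul.mp hcomm
    calc a * b * n * (a * b)⁻¹ = a * (b * n * b⁻¹) * a⁻¹ := by group
      _ = b * n * b⁻¹ := by rw [← this, mul_inv_cancel_right]
  simpa only [heq] using hm


/-- Let `p` be a prime and `N₀` a positive integer. Every finite group `G` with a
normal Sylow `p`-subgroup `P` of order at most `N₀` and cyclic quotient `G ⧸ P`
contains a normal subgroup `H` of order prime to `p` of index at most `N₀ * N₀!`. -/
theorem stmt5 (p : ℕ) [Fact p.Prime] (N₀ : ℕ) (hN₀ : 0 < N₀)
    (G : Type*) [Group G] [Finite G]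
    (P : Sylow p G) (hP : (P : Subgroup G).Normal)
    (hcard : Nat.card (P : Subgroup G) ≤ N₀)
    (hcyc : IsCyclic (G ⧸ (P : Subgroup G))) :
    ∃ H : Subgroup G, H.Normal ∧ (Nat.card H).Coprime p ∧
      H.index ≤ N₀ * Nat.factorial N₀ := by
  obtain ⟨K, hK⟩ := Subgroup.exists_right_complement'_of_coprime P.card_coprime_index
  refine ⟨K ⊓ (MulAut.conjNormal (H := (P : Subgroup G))).ker, hK.normal_inf_ker_conjNormal,
    ?_, ?_⟩
  · have hKp : (Nat.card K).Coprime p := by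
      rw [← hK.symm.index_eq_card]
      exact ((Fact.out : p.Prime).coprime_iff_not_dvd.mpr P.not_dvd_index).symm
    exact hKp.coprime_dvd_left (Subgroup.card_dvd_of_le inf_le_left)
  · refine Subgroup.index_inf_le.trans (Nat.mul_le_mul ?_ ?_)
    · rwa [hK.index_eq_card]
    · exact (Subgroup.index_ker_conjNormal_le _).trans (Nat.factorial_le hcard)
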